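/- arXiv:2412.05326 — 2 statements merged into one kernel-verified Lean document; each statement's English description precedes it below -/
import Mathlib

section
/- Let (T_t)_{t∈ℝ} be an ergodic measurable measure-preserving flow on a probability space (X,μ) and let f : X → ℝ be integrable. Then for μ-almost every x ∈ X there exists a sequence t_k → ∞ such that ∫_0^{t_k} f(T_s x) ds = t_k · ∫_X f dμ for all k. -/
open MeasureTheory Filter

/-- A real sequence tending to `+∞` has an index after which it stays uniformly above the value
taken at that index. -/
theorem exists_iInf_sub_pos {u : ℕ → ℝ} (hu : Tendsto u atTop atTop) :
    ∃ N, 0 < ⨅ m, (u (N + (m + 1)) - u N) := by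
  obtain ⟨n, hn⟩ := (Nat.cofinite_eq_atTop ▸ hu : Tendsto u cofinite atTop).exists_forall_le
  obtain ⟨b, hb⟩ := eventually_atTop.1 (hu.eventually (eventually_gt_atTop (u n)))
  have hfin : {m | u m ≤ u n}.Finite :=
    (Set.finite_lt_nat b).subset fun m hm => not_le.1 fun h => (hb m h).not_ge hm
  obtain ⟨N, hN, hmax⟩ := hfin.exists_maximal ⟨n, le_refl (u n)⟩
  have hlim : Tendsto (fun m => u (N + (m + 1)) - u N) cofinite atTop := by
    rw [Nat.cofinite_eq_atTop]
    refine tendsto_atTop_add_const_right _ _ (hu.comp ?_)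
    exact tendsto_atTop_mono (fun m => by omega : ∀ m, m ≤ N + (m + 1)) tendsto_id
  obtain ⟨m₀, hm₀⟩ := hlim.exists_forall_le
  refine ⟨N, lt_of_lt_of_le ?_ (le_ciInf hm₀)⟩
  by_contra! h
  have : N + (m₀ + 1) ≤ N := hmax (show u (N + (m₀ + 1)) ≤ u n by
    have : u N ≤ u n := hN
    linarith) (by omega)
  omega

/-- If the Birkhoff sums of an integrable function over a measure-preserving map tend to `+∞`
almost everywhere, then the function has positive integral. -/
theorem integral_pos_of_tendsto_birkhoffSum {X : Type*} [MeasurableSpace X] {μ : Measure X}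
    [IsProbabilityMeasure μ] {T : X → X} (hT : MeasurePreserving T μ μ) {φ : X → ℝ}
    (hφm : Measurable φ) (hφ : Integrable φ μ)
    (hlim : ∀ᵐ x ∂μ, Tendsto (fun n => birkhoffSum T φ n x) atTop atTop) :
    0 < ∫ x, φ x ∂μ := by
  set B : ℕ → X → ℝ := birkhoffSum T φ with hB
  set M : X → ℝ := fun x => ⨅ n, B n x with hM
  set M₁ : X → ℝ := fun x => ⨅ n, B (n + 1) x with hM₁
  have hBm (n : ℕ) : Measurable (B n) :=
    Finset.measurable_sum _ fun i _ => hφm.comp (hT.measurable.iterate i)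
  have hMm : Measurable M := Measurable.iInf hBm
  have hM₁m : Measurable M₁ := Measurable.iInf fun n => hBm (n + 1)
  have hbdd {x : X} (hx : Tendsto (fun n => B n x) atTop atTop) :
      BddBelow (Set.range fun n => B n x) := by
    obtain ⟨n, hn⟩ := (Nat.cofinite_eq_atTop ▸ hx :
      Tendsto (fun n => B n x) cofinite atTop).exists_forall_le
    exact ⟨B n x, by rintro _ ⟨m, rfl⟩; exact hn m⟩
  have hrec : ∀ᵐ x ∂μ, M (T x) = M₁ x - φ x ∧ M x = min 0 (M₁ x) := by
    filter_upwards [hlim, hT.quasiMeasurePreserving.ae hlim] with x hx hTx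
    constructor
    · have : M₁ x = ⨅ n, (φ x + B n (T x)) := by
        simp only [hM₁, hB, birkhoffSum_succ']
      rw [this, ← add_ciInf (hbdd hTx)]
      ring
    · have hb := hbdd hx
      have hb₁ : BddBelow (Set.range fun n => B (n + 1) x) :=
        hb.mono (by rintro _ ⟨n, rfl⟩; exact ⟨n + 1, rfl⟩)
      apply le_antisymm
      · refine le_min ?_ (le_ciInf fun n => ciInf_le hb (n + 1))
        simpa [hB] using ciInf_le hb 0
      · refine le_ciInf fun n => ?_
        cases n with
        | zero => simp [hB]
        | succ n => exact (min_le_right _ _).trans (ciInf_le hb₁ n)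
  set P : X → ℝ := fun x => max (M₁ x) 0 with hP
  have hPm : Measurable P := hM₁m.max measurable_const
  set Mt : ℕ → X → ℝ := fun k x => max (min (M x) 0) (-k) with hMt
  have hMtm (k : ℕ) : Measurable (Mt k) := (hMm.min measurable_const).max measurable_const
  have hMti (k : ℕ) : Integrable (Mt k) μ := by
    refine Integrable.of_bound (hMtm k).aestronglyMeasurable k (ae_of_all _ fun x => ?_)
    rw [Real.norm_eq_abs, abs_le]
    exact ⟨le_max_right _ _, max_le ((min_le_right _ _).trans (by positivity)) (by
      have : (0 : ℝ) ≤ k := by positivity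
      linarith)⟩
  set d : ℕ → X → ℝ := fun k x => Mt k (T x) - Mt k x + |φ x| with hd
  have hdi (k : ℕ) : Integrable (d k) μ :=
    ((hT.integrable_comp_of_integrable (hMti k)).sub (hMti k)).add hφ.abs
  have hdint (k : ℕ) : ∫ x, d k x ∂μ = ∫ x, |φ x| ∂μ := by
    have h1 : ∫ x, Mt k (T x) ∂μ = ∫ x, Mt k x ∂μ := by
      have := integral_map (μ := μ) hT.measurable.aemeasurable
        (f := Mt k) (hMtm k).aestronglyMeasurable
      rw [hT.map_eq] at this
      exact this.symm
    have hi : Integrable (fun x => Mt k (T x)) μ := hT.integrable_comp_of_integrable (hMti k)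
    rw [integral_add (f := fun x => Mt k (T x) - Mt k x) (hi.sub (hMti k)) hφ.abs,
      integral_sub hi (hMti k), h1, sub_self, zero_add]
  have hd0 : ∀ᵐ x ∂μ, ∀ k, 0 ≤ d k x := by
    filter_upwards [hrec] with x ⟨h1, h2⟩ k
    have h3 : M x ≤ M (T x) + |φ x| := by
      rw [h1, h2]
      linarith [min_le_right 0 (M₁ x), le_abs_self (φ x)]
    have h4 := abs_nonneg (φ x)
    have : Mt k x ≤ Mt k (T x) + |φ x| := by
      simp only [hMt]
      rcases max_cases (min (M (T x)) 0) (-(k : ℝ)) with h | h <;>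
      rcases min_cases (M (T x)) 0 with h' | h' <;>
      rcases max_cases (min (M x) 0) (-(k : ℝ)) with h'' | h'' <;>
      rcases min_cases (M x) 0 with h''' | h''' <;> linarith
    simp only [hd]
    linarith
  have hdlim : ∀ᵐ x ∂μ, Tendsto (fun k => ENNReal.ofReal (d k x)) atTop
      (nhds (ENNReal.ofReal (P x - φ x + |φ x|))) := by
    filter_upwards [hrec, hT.quasiMeasurePreserving.ae hrec] with x ⟨h1, h2⟩ ⟨_, h3⟩
    refine ENNReal.tendsto_ofReal (tendsto_const_nhds.congr' ?_)
    have key (y : X) (hy : M y = min 0 (M₁ y)) : ∀ᶠ k : ℕ in atTop, Mt k y = M y := by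
      filter_upwards [tendsto_natCast_atTop_atTop.eventually (eventually_ge_atTop (-M y))]
        with k hk
      have : M y ≤ 0 := hy ▸ min_le_left _ _
      simp only [hMt, min_eq_left this]
      exact max_eq_left (by linarith)
    filter_upwards [key x h2, key (T x) h3] with k hk hk'
    simp only [hd, hP, hk, hk', h1, h2]
    rcases max_cases (M₁ x) 0 with h | h <;> rcases min_cases 0 (M₁ x) with h' | h' <;> linarith
  have hdm (k : ℕ) : Measurable (d k) := by
    exact (((hMtm k).comp hT.measurable).sub (hMtm k)).add hφm.abs
  have hfatou : ∫⁻ x, ENNReal.ofReal (P x - φ x + |φ x|) ∂μ ≤ ENNReal.ofReal (∫ x, |φ x| ∂μ) := by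
    calc ∫⁻ x, ENNReal.ofReal (P x - φ x + |φ x|) ∂μ
        = ∫⁻ x, liminf (fun k => ENNReal.ofReal (d k x)) atTop ∂μ :=
          lintegral_congr_ae (hdlim.mono fun x hx => hx.liminf_eq.symm)
      _ ≤ liminf (fun k => ∫⁻ x, ENNReal.ofReal (d k x) ∂μ) atTop :=
          lintegral_liminf_le fun k => (hdm k).ennreal_ofReal
      _ = ENNReal.ofReal (∫ x, |φ x| ∂μ) := by
          have (k : ℕ) : ∫⁻ x, ENNReal.ofReal (d k x) ∂μ = ENNReal.ofReal (∫ x, |φ x| ∂μ) := by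
            rw [← hdint k, ofReal_integral_eq_lintegral_ofReal (hdi k)
              (hd0.mono fun x hx => hx k)]
          simp [this]
  have hnn (x : X) : 0 ≤ P x - φ x + |φ x| := by
    have : 0 ≤ P x := le_max_right _ _
    linarith [le_abs_self (φ x)]
  have hQi : Integrable (fun x => P x - φ x + |φ x|) μ := by
    refine ⟨((hPm.sub hφm).add hφm.abs).aestronglyMeasurable, ?_⟩
    rw [hasFiniteIntegral_iff_ofReal (ae_of_all _ hnn)]
    exact hfatou.trans_lt ENNReal.ofReal_lt_top
  have hPi : Integrable P μ := by
    refine ((hQi.sub hφ.abs).add hφ).congr (ae_of_all _ fun x => ?_)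
    simp only [Pi.add_apply, Pi.sub_apply]
    ring
  have hPle : ∫ x, P x ∂μ ≤ ∫ x, φ x ∂μ := by
    rw [← ofReal_integral_eq_lintegral_ofReal hQi (ae_of_all _ hnn),
      ENNReal.ofReal_le_ofReal_iff (integral_nonneg fun x => abs_nonneg _),
      integral_add (f := fun x => P x - φ x) (hPi.sub hφ) hφ.abs, integral_sub hPi hφ] at hfatou
    linarith
  by_contra! hneg
  have hP0 : P =ᵐ[μ] 0 := by
    refine (integral_eq_zero_iff_of_nonneg (fun x => le_max_right _ _) hPi).1 ?_
    exact le_antisymm (hPle.trans hneg) (integral_nonneg fun x => le_max_right _ _)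
  have hall : ∀ᵐ x ∂μ, ∀ n, P (T^[n] x) = 0 :=
    ae_all_iff.2 fun n => (hT.iterate n).quasiMeasurePreserving.ae hP0
  obtain ⟨x, hx, hlimx⟩ := (hall.and hlim).exists
  obtain ⟨N, hN⟩ := exists_iInf_sub_pos hlimx
  have : M₁ (T^[N] x) ≤ 0 := (le_max_left _ _).trans (hx N).le
  refine this.not_gt ?_
  simpa [hM₁, hB, birkhoffSum_add] using hN

/-- The ergodic integral of `g` up to time `t` along the orbit of `x`. -/
noncomputable def flowIntegral {X : Type*} (T : ℝ → X → X) (g : X → ℝ) (t : ℝ) (x : X) : ℝ :=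
  ∫ s in (0 : ℝ)..t, g (T s x)

/-- `g` is locally integrable along the orbit of `x`. -/
def OrbitIntegrable {X : Type*} (T : ℝ → X → X) (g : X → ℝ) (x : X) : Prop :=
  ∀ a b, IntervalIntegrable (fun s => g (T s x)) volume a b

section Orbit

variable {X : Type*} {T : ℝ → X → X} {g : X → ℝ} {x : X}

theorem OrbitIntegrable.map (hTadd : ∀ s t : ℝ, T (s + t) = T s ∘ T t)
    (hx : OrbitIntegrable T g x) (r : ℝ) : OrbitIntegrable T g (T r x) := by
  intro a b
  have := (hx (a + r) (b + r)).comp_add_right r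
  simpa [hTadd] using this

/-- The cocycle identity for ergodic integrals. -/
theorem flowIntegral_add (hTadd : ∀ s t : ℝ, T (s + t) = T s ∘ T t)
    (hx : OrbitIntegrable T g x) (r t : ℝ) :
    flowIntegral T g (t + r) x = flowIntegral T g r x + flowIntegral T g t (T r x) := by
  have h : flowIntegral T g t (T r x) = ∫ s in r..(t + r), g (T s x) := by
    have := intervalIntegral.integral_comp_add_right (a := 0) (b := t) (fun s => g (T s x)) r
    simpa [hTadd, flowIntegral] using this
  rw [h, flowIntegral, flowIntegral,
    intervalIntegral.integral_add_adjacent_intervals (hx _ _) (hx _ _)]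

theorem continuous_flowIntegral (hx : OrbitIntegrable T g x) :
    Continuous fun t => flowIntegral T g t x :=
  intervalIntegral.continuous_primitive hx 0

theorem iterate_flow_one (hT0 : T 0 = id) (hTadd : ∀ s t : ℝ, T (s + t) = T s ∘ T t) (n : ℕ) :
    (T 1)^[n] = T n := by
  induction n with
  | zero => simp [hT0]
  | succ n ih => rw [Function.iterate_succ, ih, ← hTadd, Nat.cast_succ]

theorem birkhoffSum_flowIntegral_one (hTadd : ∀ s t : ℝ, T (s + t) = T s ∘ T t)
    (hx : OrbitIntegrable T g x) (n : ℕ) :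
    birkhoffSum (T 1) (flowIntegral T g 1) n x = flowIntegral T g n x := by
  induction n generalizing x with
  | zero => simp [flowIntegral]
  | succ n ih => rw [birkhoffSum_succ', ih (hx.map hTadd 1), Nat.cast_succ,
      flowIntegral_add hTadd hx]

/-- The lower limit of the ergodic integrals, taken along rational times. -/
noncomputable def flowLiminf {X : Type*} (T : ℝ → X → X) (g : X → ℝ) (x : X) : EReal :=
  liminf (fun q : ℚ => (flowIntegral T g q x : EReal)) atTop

theorem flowLiminf_map (hTadd : ∀ s t : ℝ, T (s + t) = T s ∘ T t)
    (hx : OrbitIntegrable T g x) (q : ℚ) :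
    flowLiminf T g x = flowLiminf T g (T q x) + flowIntegral T g q x := by
  have hshift : flowLiminf T g x
      = liminf (fun p : ℚ => (flowIntegral T g (p + q : ℚ) x : EReal)) atTop := by
    have h : map (fun p : ℚ => p + q) atTop = atTop := (OrderIso.addRight q).map_atTop
    have hcomp := liminf_comp (fun p : ℚ => (flowIntegral T g p x : EReal))
      (fun p : ℚ => p + q) atTop
    rw [h] at hcomp
    exact hcomp.symm
  have hmono : Monotone fun y : EReal => y + flowIntegral T g q x :=
    fun a b hab => add_le_add_left hab _
  have hcont : ContinuousAt (fun y : EReal => y + flowIntegral T g q x)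
      (flowLiminf T g (T q x)) :=
    ContinuousAt.comp (f := fun y : EReal => (y, (flowIntegral T g q x : EReal)))
      (EReal.continuousAt_add (by simp) (by simp)) (by fun_prop)
  rw [hshift, flowLiminf, hmono.map_liminf_of_continuousAt _ hcont]
  congr 1
  ext p
  simp only [Function.comp_apply, Rat.cast_add, flowIntegral_add hTadd hx, EReal.coe_add]
  rw [add_comm]

theorem flowLiminf_eq_top_iff (hx : OrbitIntegrable T g x) :
    flowLiminf T g x = ⊤ ↔ Tendsto (fun t => flowIntegral T g t x) atTop atTop := by
  have h1 : flowLiminf T g x = ⊤ ↔ Tendsto (fun q : ℚ => flowIntegral T g q x) atTop atTop := by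
    rw [← EReal.tendsto_coe_nhds_top_iff]
    exact ⟨fun h => tendsto_of_le_liminf_of_limsup_le (h ▸ le_rfl) le_top, fun h => h.liminf_eq⟩
  rw [h1]
  refine ⟨fun h => tendsto_atTop.2 fun c => ?_, fun h => 
    h.comp (tendsto_ratCast_atTop_iff.2 tendsto_id)⟩
  obtain ⟨a, ha⟩ := eventually_atTop.1 (h.eventually (eventually_ge_atTop c))
  refine eventually_atTop.2 ⟨a + 1, fun t ht => ?_⟩
  have hcl : IsClosed {t | c ≤ flowIntegral T g t x} :=
    isClosed_le continuous_const (continuous_flowIntegral hx)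
  by_contra hlt
  have hopen : IsOpen ({t | c ≤ flowIntegral T g t x}ᶜ ∩ Set.Ioi (a : ℝ)) :=
    hcl.isOpen_compl.inter isOpen_Ioi
  obtain ⟨q, hq1, hq2⟩ := (Rat.denseRange_cast (𝕜 := ℝ)).exists_mem_open hopen
    ⟨t, hlt, show (a : ℝ) < t by linarith⟩
  exact hq1 (ha q (Rat.cast_lt.1 (Set.mem_Ioi.1 hq2)).le)

end Orbit

section Measure

variable {X : Type*} [MeasurableSpace X] {μ : Measure X} [IsProbabilityMeasure μ]
  {T : ℝ → X → X} {g : X → ℝ}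

theorem measurable_flowIntegral (hTmeas : Measurable fun p : ℝ × X => T p.1 p.2)
    (hg : Measurable g) (t : ℝ) : Measurable (flowIntegral T g t) := by
  have h : StronglyMeasurable fun p : ℝ × X => g (T p.1 p.2) :=
    (hg.comp hTmeas).stronglyMeasurable
  unfold flowIntegral
  simp only [intervalIntegral]
  exact (h.integral_prod_left'.sub h.integral_prod_left').measurable

theorem measurable_flowLiminf (hTmeas : Measurable fun p : ℝ × X => T p.1 p.2)
    (hg : Measurable g) : Measurable (flowLiminf T g) :=
  Measurable.liminf' (fun q : ℚ => (measurable_flowIntegral hTmeas hg q).coe_real_ereal)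
    atTop_countable_basis fun _ => Set.to_countable _

theorem integrable_flow (hTmp : ∀ t : ℝ, MeasurePreserving (T t) μ μ)
    (hTmeas : Measurable fun p : ℝ × X => T p.1 p.2) (hgm : Measurable g) (hg : Integrable g μ)
    (ν : Measure ℝ) [IsFiniteMeasure ν] :
    Integrable (fun p : ℝ × X => g (T p.1 p.2)) (ν.prod μ) := by
  refine (integrable_prod_iff (hgm.comp hTmeas).aestronglyMeasurable).2
    ⟨ae_of_all _ fun t => (hTmp t).integrable_comp_of_integrable hg, ?_⟩
  have (t : ℝ) : ∫ x, ‖g (T t x)‖ ∂μ = ∫ x, ‖g x‖ ∂μ := by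
    have := integral_map (μ := μ) (hTmp t).measurable.aemeasurable
      (f := fun x => ‖g x‖) hgm.norm.aestronglyMeasurable
    rw [(hTmp t).map_eq] at this
    exact this.symm
  simp only [Function.comp_apply, this]
  exact integrable_const _

theorem ae_orbitIntegrable (hTmp : ∀ t : ℝ, MeasurePreserving (T t) μ μ)
    (hTmeas : Measurable fun p : ℝ × X => T p.1 p.2) (hgm : Measurable g) (hg : Integrable g μ) :
    ∀ᵐ x ∂μ, OrbitIntegrable T g x := by
  have h : ∀ᵐ x ∂μ, ∀ n : ℕ, IntegrableOn (fun s => g (T s x)) (Set.Icc (-n : ℝ) n) volume :=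
    ae_all_iff.2 fun n => (integrable_flow hTmp hTmeas hgm hg
      (volume.restrict (Set.Icc (-n : ℝ) n))).prod_left_ae
  filter_upwards [h] with x hx a b
  obtain ⟨n, hn⟩ := exists_nat_ge (max |a| |b|)
  have ha := abs_le.1 ((le_max_left _ _).trans hn)
  have hb := abs_le.1 ((le_max_right _ _).trans hn)
  rw [intervalIntegrable_iff]
  refine (hx n).mono_set (Set.uIoc_subset_uIcc.trans (Set.uIcc_subset_Icc ha hb))

theorem integrable_flowIntegral_one (hTmp : ∀ t : ℝ, MeasurePreserving (T t) μ μ)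
    (hTmeas : Measurable fun p : ℝ × X => T p.1 p.2) (hgm : Measurable g) (hg : Integrable g μ) :
    Integrable (flowIntegral T g 1) μ := by
  have := (integrable_flow hTmp hTmeas hgm hg
    (volume.restrict (Set.Ioc (0 : ℝ) 1))).integral_prod_right
  unfold flowIntegral
  simpa only [intervalIntegral.integral_of_le zero_le_one] using this

theorem integral_flowIntegral_one (hTmp : ∀ t : ℝ, MeasurePreserving (T t) μ μ)
    (hTmeas : Measurable fun p : ℝ × X => T p.1 p.2) (hgm : Measurable g) (hg : Integrable g μ) :
    ∫ x, flowIntegral T g 1 x ∂μ = ∫ x, g x ∂μ := by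
  have h (t : ℝ) : ∫ x, g (T t x) ∂μ = ∫ x, g x ∂μ := by
    have := integral_map (μ := μ) (hTmp t).measurable.aemeasurable hgm.aestronglyMeasurable
    rw [(hTmp t).map_eq] at this
    exact this.symm
  have hswap := integral_integral_swap (f := fun s x => g (T s x)) (integrable_flow hTmp hTmeas
    hgm hg (volume.restrict (Set.Ioc (0 : ℝ) 1)))
  simp only [flowIntegral, intervalIntegral.integral_of_le zero_le_one]
  rw [← hswap]
  simp [h]

/-- For an ergodic flow and a function of nonpositive integral, the ergodic integrals do not tend
to `+∞`. -/
theorem ae_flowLiminf_ne_top (hTadd : ∀ s t : ℝ, T (s + t) = T s ∘ T t)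
    (hTmp : ∀ t : ℝ, MeasurePreserving (T t) μ μ)
    (hTmeas : Measurable fun p : ℝ × X => T p.1 p.2)
    (hTerg : ∀ E : Set X, MeasurableSet E → (∀ t : ℝ, T t ⁻¹' E =ᵐ[μ] E) → μ E = 0 ∨ μ E = 1)
    (hgm : Measurable g) (hg : Integrable g μ) (hg0 : ∫ x, g x ∂μ ≤ 0) :
    ∀ᵐ x ∂μ, flowLiminf T g x ≠ ⊤ := by
  have hreg := ae_orbitIntegrable hTmp hTmeas hgm hg
  have hEm : MeasurableSet {x | flowLiminf T g x = ⊤} :=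
    measurable_flowLiminf hTmeas hgm (measurableSet_singleton ⊤)
  have hinv (r : ℝ) : T r ⁻¹' {x | flowLiminf T g x = ⊤} =ᵐ[μ] {x | flowLiminf T g x = ⊤} := by
    rw [eventuallyEq_set]
    filter_upwards [hreg] with x hx
    simp only [Set.mem_preimage, Set.mem_ofPred_eq]
    rw [flowLiminf_eq_top_iff hx, flowLiminf_eq_top_iff (hx.map hTadd r)]
    have h : map (fun t : ℝ => t + r) atTop = atTop := (OrderIso.addRight r).map_atTop
    rw [show Tendsto (fun t => flowIntegral T g t x) atTop atTop ↔
      Tendsto (fun t => flowIntegral T g t x) (map (fun t : ℝ => t + r) atTop) atTop by rw [h],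
      tendsto_map'_iff]
    have heq : (fun t => flowIntegral T g t x) ∘ (fun t => t + r)
        = fun t => flowIntegral T g r x + flowIntegral T g t (T r x) :=
      funext fun t => flowIntegral_add hTadd hx r t
    rw [heq]
    exact ⟨tendsto_atTop_add_const_left _ _, fun h => by
      simpa using tendsto_atTop_add_const_left _ (-flowIntegral T g r x) h⟩
  rcases hTerg _ hEm hinv with h | h
  · exact measure_eq_zero_iff_ae_notMem.1 h
  · have hE : ∀ᵐ x ∂μ, flowLiminf T g x = ⊤ := (prob_compl_eq_zero_iff hEm).2 h
    have := integral_pos_of_tendsto_birkhoffSum (hTmp 1) (measurable_flowIntegral hTmeas hgm 1)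
      (integrable_flowIntegral_one hTmp hTmeas hgm hg) (by
        filter_upwards [hreg, hE] with x hx hxE
        simp only [birkhoffSum_flowIntegral_one hTadd hx]
        exact ((flowLiminf_eq_top_iff hx).1 hxE).comp tendsto_natCast_atTop_atTop)
    rw [integral_flowIntegral_one hTmp hTmeas hgm hg] at this
    exact absurd hg0 this.not_ge

/-- For an ergodic flow and a function of nonpositive integral, almost every orbit has nonpositive
ergodic integrals at arbitrarily large times. -/
theorem ae_frequently_flowIntegral_nonpos (hT0 : T 0 = id)
    (hTadd : ∀ s t : ℝ, T (s + t) = T s ∘ T t)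
    (hTmp : ∀ t : ℝ, MeasurePreserving (T t) μ μ)
    (hTmeas : Measurable fun p : ℝ × X => T p.1 p.2)
    (hTerg : ∀ E : Set X, MeasurableSet E → (∀ t : ℝ, T t ⁻¹' E =ᵐ[μ] E) → μ E = 0 ∨ μ E = 1)
    (hgm : Measurable g) (hg : Integrable g μ) (hg0 : ∫ x, g x ∂μ ≤ 0) :
    ∀ᵐ x ∂μ, ∃ᶠ t in atTop, flowIntegral T g t x ≤ 0 := by
  have hreg := ae_orbitIntegrable hTmp hTmeas hgm hg
  have hIm := measurable_flowLiminf hTmeas hgm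
  have hcons := (hTmp 1).conservative
  have hrec0 := hcons.ae_mem_imp_frequently_image_mem
    (hIm (measurableSet_singleton 0)).nullMeasurableSet
  have hrec (k : ℕ) := hcons.ae_mem_imp_frequently_image_mem
    (hIm (measurableSet_Ioi (a := (((1 / (k + 1) : ℝ)) : EReal)))).nullMeasurableSet
  filter_upwards [hreg, hrec0, ae_all_iff.2 hrec,
    ae_flowLiminf_ne_top hTadd hTmp hTmeas hTerg hgm hg hg0] with x hx h0 hk htop
  intro hpos
  simp only [not_le] at hpos
  have hnonneg : 0 ≤ flowLiminf T g x := by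
    refine le_liminf_of_le (by isBoundedDefault) ?_
    filter_upwards [(tendsto_ratCast_atTop_iff.2 tendsto_id).eventually hpos] with q hq
    exact_mod_cast hq.le
  have hcoc (n : ℕ) :
      flowLiminf T g x = flowLiminf T g ((T 1)^[n] x) + flowIntegral T g n x := by
    simpa [iterate_flow_one hT0 hTadd] using flowLiminf_map hTadd hx n
  have hnat : ∀ {p : ℝ → Prop}, (∀ᶠ t in atTop, p t) → ∀ᶠ n : ℕ in atTop, p n :=
    fun h => tendsto_natCast_atTop_atTop.eventually h
  lift flowLiminf T g x to ℝ using ⟨htop, (EReal.bot_lt_zero.trans_le hnonneg).ne'⟩ with a ha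
  have ha0 : 0 ≤ a := by exact_mod_cast hnonneg
  rcases ha0.eq_or_lt with rfl | hapos
  · obtain ⟨n, hn, hn'⟩ := ((h0 ha.symm).and_eventually (hnat hpos)).exists
    have hz : flowLiminf T g ((T 1)^[n] x) = 0 := hn
    have := hcoc n
    rw [hz, zero_add] at this
    exact hn'.ne (by exact_mod_cast this)
  · obtain ⟨k, hka⟩ := exists_nat_one_div_lt hapos
    have hfreq := hk k (show (((1 / (k + 1) : ℝ)) : EReal) < flowLiminf T g x by
      rw [← ha]; exact_mod_cast hka)
    set ε : ℝ := 1 / (k + 1) with hε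
    have hε0 : 0 < ε := by positivity
    have hlim : ∀ᶠ q : ℚ in atTop, ((a - ε : ℝ) : EReal) < flowIntegral T g q x := by
      refine eventually_lt_of_lt_liminf (?_ : _ < flowLiminf T g x)
      rw [← ha]
      exact_mod_cast sub_lt_self a hε0
    have hlim' : ∀ᶠ n : ℕ in atTop, a - ε < flowIntegral T g n x := by
      filter_upwards [(tendsto_natCast_atTop_atTop (R := ℚ)).eventually hlim] with n hn
      simpa using EReal.coe_lt_coe_iff.1 hn
    obtain ⟨n, hn, hn'⟩ := (hfreq.and_eventually hlim').exists
    have hn : (ε : EReal) < flowLiminf T g ((T 1)^[n] x) := hn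
    have : (a : EReal) < a := by
      calc (a : EReal) = ((ε + (a - ε) : ℝ) : EReal) := by congr 1; ring
        _ = (ε : EReal) + ((a - ε : ℝ) : EReal) := EReal.coe_add _ _
        _ < flowLiminf T g ((T 1)^[n] x) + flowIntegral T g n x :=
          EReal.add_lt_add hn (EReal.coe_lt_coe_iff.2 hn')
        _ = a := (hcoc n).symm
    exact lt_irrefl _ this

theorem ae_flowIntegral_congr (hTmp : ∀ t : ℝ, MeasurePreserving (T t) μ μ)
    (hTmeas : Measurable fun p : ℝ × X => T p.1 p.2) {f : X → ℝ} (hfg : f =ᵐ[μ] g) :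
    ∀ᵐ x ∂μ, ∀ t, flowIntegral T f t x = flowIntegral T g t x := by
  have hq : Measure.QuasiMeasurePreserving (fun p : ℝ × X => T p.1 p.2) (volume.prod μ) μ :=
    QuasiMeasurePreserving.prod_of_right hTmeas (ae_of_all _ fun t => (hTmp t).quasiMeasurePreserving)
  have h := Measure.ae_ae_of_ae_prod
    ((hq.comp Measure.measurePreserving_swap.quasiMeasurePreserving).ae hfg)
  filter_upwards [h] with x hx t
  exact intervalIntegral.integral_congr_ae (hx.mono fun s hs _ => hs)

end Measure

/-- For an ergodic measure-preserving flow on a probability space and integrable `f`,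
a.e. `x` admits times `t k → ∞` at which the ergodic integral exactly equals
`t k · ∫ f dμ`. -/
theorem exact_mean_times_flow
    {X : Type*} [MeasurableSpace X] (μ : Measure X) [IsProbabilityMeasure μ]
    (T : ℝ → X → X)
    (hT0 : T 0 = id)
    (hTadd : ∀ s t : ℝ, T (s + t) = T s ∘ T t)
    (hTmp : ∀ t : ℝ, MeasurePreserving (T t) μ μ)
    (hTmeas : Measurable fun p : ℝ × X => T p.1 p.2)
    (hTerg : ∀ E : Set X, MeasurableSet E → (∀ t : ℝ, T t ⁻¹' E =ᵐ[μ] E) →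
      μ E = 0 ∨ μ E = 1)
    (f : X → ℝ) (hf : Integrable f μ) :
    ∀ᵐ x ∂μ, ∃ t : ℕ → ℝ, Tendsto t atTop atTop ∧
      ∀ k : ℕ, (∫ s in (0:ℝ)..(t k), f (T s x)) = t k * ∫ y, f y ∂μ := by
  obtain ⟨f', hf'm, hff'⟩ := hf.1.aemeasurable
  have hf' : Integrable f' μ := hf.congr hff'
  set m := ∫ y, f y ∂μ with hm
  have hm' : ∫ y, f' y ∂μ = m := (integral_congr_ae hff').symm
  set g : X → ℝ := fun x => f' x - m with hg
  have hgm : Measurable g := hf'm.sub_const m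
  have hgi : Integrable g μ := hf'.sub (integrable_const m)
  have hg0 : ∫ x, g x ∂μ = 0 := by
    simp [hg, integral_sub hf' (integrable_const m), hm']
  filter_upwards [ae_orbitIntegrable hTmp hTmeas hgm hgi,
    ae_orbitIntegrable hTmp hTmeas hf'm hf', ae_flowIntegral_congr hTmp hTmeas hff',
    ae_frequently_flowIntegral_nonpos hT0 hTadd hTmp hTmeas hTerg hgm hgi hg0.le,
    ae_frequently_flowIntegral_nonpos hT0 hTadd hTmp hTmeas hTerg hgm.neg hgi.neg
      (by simp [integral_neg, hg0])] with x hx hx' hcongr hnonpos hnonneg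
  have hzero (n : ℕ) : ∃ t : ℝ, n ≤ t ∧ flowIntegral T g t x = 0 := by
    obtain ⟨a, ha, ha'⟩ := frequently_atTop.1 hnonpos n
    obtain ⟨b, hb, hb'⟩ := frequently_atTop.1 hnonneg n
    have hb' : 0 ≤ flowIntegral T g b x := by
      simpa [flowIntegral, intervalIntegral.integral_neg] using hb'
    obtain ⟨t, ht, ht'⟩ := intermediate_value_uIcc
      (continuous_flowIntegral hx).continuousOn (Set.Icc_subset_uIcc ⟨ha', hb'⟩)
    exact ⟨t, (le_min ha hb).trans ht.1, ht'⟩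
  choose t ht ht0 using hzero
  refine ⟨t, tendsto_atTop_mono ht tendsto_natCast_atTop_atTop, fun k => ?_⟩
  change flowIntegral T f (t k) x = _
  have h := ht0 k
  simp only [flowIntegral, hg] at h
  rw [intervalIntegral.integral_sub (hx' _ _) intervalIntegrable_const] at h
  rw [hcongr, flowIntegral]
  simp only [intervalIntegral.integral_const, sub_zero, smul_eq_mul] at h
  linarith
end

section
/- (Consequence of Weiss, Theorem 1.4) Let (X,μ) be a probability space, S an invertible measure-preserving transformation of (X,μ), and f : X → ℤ a measurable function such that for every ε > 0, μ({x : |∑_{i=0}^{n-1} f(Sⁱ x)| > ε n}) → 0 as n → ∞. Then for μ-almost every x ∈ X the set {n ∈ ℕ : ∑_{i=0}^{n-1} f(Sⁱ x) = 0} is infinite. -/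
open MeasureTheory Filter Topology

section Recurrence

variable {X : Type*}

/-- The points at which no Birkhoff sum of positive length vanishes. -/
def neverZeroSet (T : X → X) (f : X → ℤ) : Set X :=
  {x | ∀ n : ℕ, 0 < n → birkhoffSum T f n x ≠ 0}

/-- Birkhoff sums take distinct values at the visit times to `neverZeroSet`. -/
theorem injOn_birkhoffSum_visits (T : X → X) (f : X → ℤ) (x : X) :
    Set.InjOn (fun i : ℕ => birkhoffSum T f i x) {i | T^[i] x ∈ neverZeroSet T f} := by
  have key : ∀ i j : ℕ, i < j → T^[i] x ∈ neverZeroSet T f →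
      birkhoffSum T f i x ≠ birkhoffSum T f j x := by
    intro i j hij hi h
    obtain ⟨k, rfl⟩ := Nat.exists_eq_add_of_le hij.le
    rw [birkhoffSum_add] at h
    exact hi k (by omega) (by linarith)
  intro i hi j hj h
  rcases lt_trichotomy i j with hij | hij | hij
  · exact (key i j hij hi h).elim
  · exact hij
  · exact (key j i hij hj h.symm).elim

/-- Visits to `neverZeroSet` before time `n` either occur when the Birkhoff sum is in
`[-ε n, ε n]`, which contains few integers, or at a time of large deviation. -/
theorem card_visits_le (T : X → X) (f : X → ℤ) (x : X) {ε : ℝ} (hε : 0 < ε) (n : ℕ)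
    [DecidablePred fun i : ℕ => T^[i] x ∈ neverZeroSet T f]
    [DecidablePred fun i : ℕ => ε * i < |((birkhoffSum T f i x : ℤ) : ℝ)|] :
    ((Finset.range n).filter fun i => T^[i] x ∈ neverZeroSet T f).card ≤
      (2 * ⌊ε * n⌋₊ + 1) +
        ((Finset.range n).filter fun i => ε * i < |((birkhoffSum T f i x : ℤ) : ℝ)|).card := by
  classical
  set m := ⌊ε * n⌋₊
  set V := (Finset.range n).filter fun i => T^[i] x ∈ neverZeroSet T f
  set D := (Finset.range n).filter fun i : ℕ => ε * i < |((birkhoffSum T f i x : ℤ) : ℝ)|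
  have hVD : (V \ D).card ≤ 2 * m + 1 := by
    have hle : (V \ D).card ≤ (Finset.Icc (-(m : ℤ)) m).card := by
      refine Finset.card_le_card_of_injOn (fun i => birkhoffSum T f i x) ?_ ?_
      · intro i hi
        simp only [V, D, Finset.coe_sdiff, Finset.coe_filter, Finset.mem_range, Set.mem_sdiff,
          Set.mem_ofPred_eq, not_and, not_lt] at hi
        have hin : (i : ℝ) ≤ n := by exact_mod_cast hi.1.1.le
        have habs : ((birkhoffSum T f i x).natAbs : ℝ) ≤ ε * n := by
          rw [Nat.cast_natAbs, Int.cast_abs]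
          exact (hi.2 hi.1.1).trans (by gcongr)
        have := Nat.le_floor habs
        simp only [Finset.coe_Icc, Set.mem_Icc]
        omega
      · refine (injOn_birkhoffSum_visits T f x).mono fun i hi => ?_
        simp only [V, Finset.coe_sdiff, Finset.coe_filter, Set.mem_sdiff] at hi
        exact hi.1.2
    refine hle.trans_eq ?_
    rw [Int.card_Icc]
    omega
  calc V.card ≤ (V \ D).card + D.card := Finset.card_le_card_sdiff_add_card
    _ ≤ _ := by gcongr

variable [MeasurableSpace X]

theorem measurable_birkhoffSum {T : X → X} (hT : Measurable T) {f : X → ℤ}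
    (hf : Measurable f) (n : ℕ) : Measurable (birkhoffSum T f n) :=
  Finset.measurable_fun_sum _ fun i _ => hf.comp (hT.iterate i)

theorem measurableSet_neverZeroSet {T : X → X} (hT : Measurable T) {f : X → ℤ}
    (hf : Measurable f) : MeasurableSet (neverZeroSet T f) := by
  have : neverZeroSet T f = ⋂ (n : ℕ) (_ : 0 < n), birkhoffSum T f n ⁻¹' {0}ᶜ := by
    ext x
    simp [neverZeroSet]
  rw [this]
  exact .iInter fun n => .iInter fun _ => measurable_birkhoffSum hT hf n (.of_discrete)

theorem measurableSet_largeDeviation {T : X → X} (hT : Measurable T) {f : X → ℤ}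
    (hf : Measurable f) (ε : ℝ) (n : ℕ) :
    MeasurableSet {x | ε * n < |((birkhoffSum T f n x : ℤ) : ℝ)|} :=
  measurable_birkhoffSum hT hf n (MeasurableSet.of_discrete (s := {k : ℤ | ε * n < |(k : ℝ)|}))

variable {μ : Measure X} [IsProbabilityMeasure μ] {T : X → X} {f : X → ℤ}

theorem mul_measureReal_neverZeroSet_le (hT : MeasurePreserving T μ μ) (hf : Measurable f)
    {ε : ℝ} (hε : 0 < ε) (n : ℕ) :
    n * μ.real (neverZeroSet T f) ≤ (2 * (ε * n) + 1) +
      ∑ i ∈ Finset.range n, μ.real {x | ε * i < |((birkhoffSum T f i x : ℤ) : ℝ)|} := by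
  classical
  have hA := measurableSet_neverZeroSet hT.measurable hf
  have hB := measurableSet_largeDeviation hT.measurable hf ε
  have hV : ∀ i, MeasurableSet (T^[i] ⁻¹' neverZeroSet T f) :=
    fun i => hT.measurable.iterate i hA
  have hint : ∀ {s : Set X}, MeasurableSet s → Integrable (s.indicator (1 : X → ℝ)) μ :=
    fun hs => (integrable_const (1 : ℝ)).indicator hs
  calc n * μ.real (neverZeroSet T f)
      = ∑ i ∈ Finset.range n, μ.real (T^[i] ⁻¹' neverZeroSet T f) := by
        simp [fun i => (hT.iterate i).measureReal_preimage hA.nullMeasurableSet]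
    _ = ∫ x, ∑ i ∈ Finset.range n,
          (T^[i] ⁻¹' neverZeroSet T f).indicator (1 : X → ℝ) x ∂μ := by
        rw [integral_finsetSum _ fun i _ => hint (hV i)]
        exact Finset.sum_congr rfl fun i _ => (integral_indicator_one (hV i)).symm
    _ ≤ ∫ x, ((2 * (ε * n) + 1) + ∑ i ∈ Finset.range n,
          {x | ε * i < |((birkhoffSum T f i x : ℤ) : ℝ)|}.indicator (1 : X → ℝ) x) ∂μ := by
        refine integral_mono (integrable_finsetSum _ fun i _ => hint (hV i))
          ((integrable_const _).add (integrable_finsetSum _ fun i _ => hint (hB i))) fun x => ?_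
        simp only [Set.indicator_apply, Set.mem_preimage, Set.mem_ofPred_eq, Pi.one_apply,
          Finset.sum_boole]
        have hcard : (_ : ℝ) ≤ _ := Nat.cast_le.mpr (card_visits_le T f x hε n)
        have hfloor : (⌊ε * n⌋₊ : ℝ) ≤ ε * n := Nat.floor_le (by positivity)
        push_cast at hcard
        linarith
    _ = _ := by
        rw [integral_add (integrable_const _) (integrable_finsetSum _ fun i _ => hint (hB i)),
          integral_finsetSum _ fun i _ => hint (hB i)]
        simp [fun i => integral_indicator_one (μ := μ) (hB i)]

theorem measure_neverZeroSet_eq_zero (hT : MeasurePreserving T μ μ) (hf : Measurable f)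
    (hsmall : ∀ ε : ℝ, 0 < ε → Tendsto
      (fun n : ℕ => μ {x | ε * n < |((birkhoffSum T f n x : ℤ) : ℝ)|}) atTop (𝓝 0)) :
    μ (neverZeroSet T f) = 0 := by
  rw [← measureReal_eq_zero_iff]
  refine le_antisymm (le_of_forall_pos_le_add fun δ hδ => ?_) measureReal_nonneg
  have hε : 0 < δ / 2 := by positivity
  have hces := ((ENNReal.tendsto_toReal ENNReal.zero_ne_top).comp (hsmall _ hε)).cesaro
  have hlim := (tendsto_inv_atTop_nhds_zero_nat (𝕜 := ℝ)).const_add δ |>.add hces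
  simp only [ENNReal.toReal_zero, add_zero] at hlim
  rw [zero_add]
  refine ge_of_tendsto hlim ?_
  filter_upwards [eventually_gt_atTop 0] with n hn
  have hn' : (0 : ℝ) < n := by exact_mod_cast hn
  have h := mul_le_mul_of_nonneg_left (mul_measureReal_neverZeroSet_le hT hf hε n)
    (inv_nonneg.mpr hn'.le)
  rw [inv_mul_cancel_left₀ hn'.ne'] at h
  refine h.trans_eq ?_
  rw [mul_add]
  congr 1
  field_simp

end Recurrence

/-- If the forward orbit of `x` avoids `neverZeroSet`, the Birkhoff sums at `x` vanish
infinitely often. -/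
theorem infinite_birkhoffSum_eq_zero {X : Type*} {T : X → X} {f : X → ℤ} {x : X}
    (hx : ∀ k : ℕ, T^[k] x ∉ neverZeroSet T f) :
    {n : ℕ | birkhoffSum T f n x = 0}.Infinite := by
  have hret : ∀ k : ℕ, ∃ n : ℕ, 0 < n ∧ birkhoffSum T f n (T^[k] x) = 0 := by
    simpa [neverZeroSet] using hx
  refine Set.infinite_of_forall_exists_gt fun N => ?_
  induction N with
  | zero =>
    obtain ⟨n, hn, h⟩ := hret 0
    exact ⟨n, h, hn⟩
  | succ N ih =>
    obtain ⟨n, hn, hNn⟩ := ih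
    obtain ⟨k, hk, h⟩ := hret n
    refine ⟨n + k, ?_, by omega⟩
    rw [Set.mem_ofPred_eq] at hn ⊢
    rw [birkhoffSum_add, hn, h, add_zero]



/-- Consequence of Weiss, Theorem 1.4: if the Birkhoff sums of `f : X → ℤ` over an
automorphism `S` of a probability space satisfy
`μ {x : |∑_{i<n} f(Sⁱ x)| > ε n} → 0` for every `ε > 0`, then for a.e. `x` the set of
`n` with vanishing Birkhoff sum is infinite. -/
theorem weiss_recurrence
    {X : Type*} [MeasurableSpace X]
    (μ : Measure X) [IsProbabilityMeasure μ]
    (S : X ≃ᵐ X) (hS : MeasurePreserving S μ μ)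
    (f : X → ℤ) (hfm : Measurable f)
    (hsmall : ∀ ε : ℝ, 0 < ε →
      Tendsto (fun n : ℕ =>
          μ {x : X | ε * n < |(∑ i ∈ Finset.range n, f ((⇑S)^[i] x) : ℝ)|})
        atTop (𝓝 0)) :
    ∀ᵐ x ∂μ, {n : ℕ | ∑ i ∈ Finset.range n, f ((⇑S)^[i] x) = 0}.Infinite := by
  have hnull : μ (neverZeroSet S f) = 0 :=
    measure_neverZeroSet_eq_zero hS hfm (by simpa [birkhoffSum] using hsmall)
  have horbit : ∀ᵐ x ∂μ, ∀ k : ℕ, S^[k] x ∉ neverZeroSet S f :=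
    ae_all_iff.mpr fun k =>
      (hS.iterate k).quasiMeasurePreserving.ae (measure_eq_zero_iff_ae_notMem.mp hnull)
  filter_upwards [horbit] with x hx
  exact infinite_birkhoffSum_eq_zero hx
end
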